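/- Let A be a unital Banach algebra over ℝ and N ∈ A. Define D_k : ℝ → A for k ∈ ℕ by D_0(t) = 1 and D_{k+1}(t) = ∫₀^t (e^{−s} · N) · D_k(s) ds (Bochner integral of the A-valued integrand). Then for every k ∈ ℕ and t ∈ ℝ, D_k(t) = ((1 − e^{−t})^k / k!) · N^k. In particular D_k(t) converges to (1/k!) · N^k as t → ∞, so the Connes–Kreimer coefficients d_k = ∫_{s₁≥⋯≥s_k≥0} θ_{−s₁}(N)⋯θ_{−s_k}(N) ds equal N^k/k!, and the negative part of the Birkhoff decomposition is φ⁻(z) = exp(−N/z). (Theorem 5.1.) -/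

import Mathlib

open Filter

/-- The Banach-algebra-valued iterated integrals D_0(t) = 1,
D_{k+1}(t) = ∫₀ᵗ (e^{−s}·N)·D_k(s) ds of Theorem 5.1, whose limits as t → ∞
are the Connes–Kreimer coefficients d_k. -/
noncomputable def ckCoeff {A : Type*} [NormedRing A] [NormedAlgebra ℝ A]
    [CompleteSpace A] (N : A) : ℕ → ℝ → A
  | 0 => fun _ => 1
  | k + 1 => fun t => ∫ s in (0:ℝ)..t, (Real.exp (-s) • N) * ckCoeff N k s

theorem hasDerivAt_one_sub_exp_neg_pow_div_factorial (k : ℕ) (s : ℝ) :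
    HasDerivAt (fun t : ℝ => (1 - Real.exp (-t)) ^ (k + 1) / ((k + 1).factorial : ℝ))
      (Real.exp (-s) * ((1 - Real.exp (-s)) ^ k / (k.factorial : ℝ))) s := by
  have h := ((((hasDerivAt_neg s).exp.const_sub 1).pow (k + 1)).div_const
    ((k + 1).factorial : ℝ))
  refine h.congr_deriv ?_
  have hk : (k.factorial : ℝ) ≠ 0 := by positivity
  rw [Nat.factorial_succ]
  push_cast
  field_simp

theorem ckCoeff_apply {A : Type*} [NormedRing A] [NormedAlgebra ℝ A]
    [CompleteSpace A] (N : A) (k : ℕ) (t : ℝ) :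
    ckCoeff N k t = ((1 - Real.exp (-t)) ^ k / (k.factorial : ℝ)) • N ^ k := by
  induction k generalizing t with
  | zero => simp [ckCoeff]
  | succ k ih =>
    simp only [ckCoeff, ih, smul_mul_smul_comm, ← pow_succ']
    rw [intervalIntegral.integral_smul_const,
      intervalIntegral.integral_eq_sub_of_hasDerivAt
        (fun s _ => hasDerivAt_one_sub_exp_neg_pow_div_factorial k s)
        (Continuous.intervalIntegrable (by fun_prop) _ _)]
    simp

/-- Theorem 5.1 (computation of the Connes–Kreimer coefficients): for N in a
real unital Banach algebra, D_k(t) = ((1 − e^{−t})^k / k!)·N^k for all t, and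
D_k(t) → (1/k!)·N^k as t → ∞, so d_k = N^k/k! and φ⁻(z) = exp(−N/z). -/
theorem ckCoeff_eq {A : Type*} [NormedRing A] [NormedAlgebra ℝ A]
    [CompleteSpace A] (N : A) (k : ℕ) :
    (∀ t : ℝ, ckCoeff N k t = ((1 - Real.exp (-t)) ^ k / (Nat.factorial k)) • N ^ k) ∧
    Tendsto (fun t : ℝ => ckCoeff N k t) atTop
      (nhds (((Nat.factorial k : ℝ))⁻¹ • N ^ k)) := by
  refine ⟨ckCoeff_apply N k, ?_⟩
  simp only [ckCoeff_apply]
  refine Tendsto.smul_const ?_ _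
  simpa using (((tendsto_const_nhds (x := (1 : ℝ))).sub
    (Real.tendsto_exp_neg_atTop_nhds_zero)).pow k).div_const (k.factorial : ℝ)
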